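/- Let (w(k) : k ≥ 1) be nonnegative reals with ρ := (limsup_{k→∞} w(k)^{1/k})^{−1} > 0, fix b ∈ (0, ρ), set a = (Σ_{k≥0} (k+1)w(k+1)b^k)^{−1} and c = (Σ_{k≥1} w(k)b^k)^{−1} (assumed positive and finite), and define probability measures μ(k) = a(k+1)w(k+1)b^k for k ≥ 0 and μ_∅(k) = c·w(k)b^k for k ≥ 1. Then for every n with Z_n^w > 0 and every plane tree τ with n vertices, (1/Z_n^w)·Σ_{θ ∈ NC_n, S(θ)=τ} Ω^w(θ) = BGW^{μ_∅,μ}(τ) / BGW^{μ_∅,μ}(T_n); that is, the law of the shape of a noncrossing tree sampled according to ℙ_n^w is the modified Bienaymé–Galton–Watson law BGW_n^{μ_∅,μ} conditioned to have n vertices. -/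

import Mathlib

open Filter Set

noncomputable section

/-- The position `e^{-2iπk/n}` of the `k`-th among the `n`-th roots of unity,
labelled in clockwise order starting from the complex number `1`. -/
def ncPos (n k : ℕ) : ℂ := Complex.exp (-(2 * Real.pi * Complex.I) * k / n)

/-- A noncrossing tree with `n` vertices: a tree on the vertex set of `n`-th roots of unity
whose edges, drawn as straight line segments, pairwise intersect only at common endpoints. -/
structure NCTree (n : ℕ) where
  adj : SimpleGraph (Fin n)
  isTree : adj.IsTree
  noncrossing : ∀ a b c d : Fin n, adj.Adj a b → adj.Adj c d →
    ({(a : ℕ), (b : ℕ)} : Set ℕ) ≠ {(c : ℕ), (d : ℕ)} →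
    segment ℝ (ncPos n a) (ncPos n b) ∩ segment ℝ (ncPos n c) (ncPos n d) ⊆
      {z : ℂ | (z = ncPos n a ∨ z = ncPos n b) ∧ (z = ncPos n c ∨ z = ncPos n d)}

/-- A plane tree in Neveu's formalism: a finite set of finite words of positive integers,
containing the root `[]`, closed under prefixes, and such that the children of a vertex `u`
are `u1, …, u k_u`. -/
structure PlaneTree where
  verts : Finset (List ℕ)
  root_mem : [] ∈ verts
  prefix_closed : ∀ u v : List ℕ, u <+: v → v ∈ verts → u ∈ verts
  labels_pos : ∀ u ∈ verts, ∀ i ∈ u, 1 ≤ i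
  children_closed : ∀ (u : List ℕ) (i : ℕ), 1 ≤ i → u ++ [i + 1] ∈ verts → u ++ [i] ∈ verts

namespace PlaneTree

/-- The number of children of the vertex `u` in `τ`. -/
def kc (τ : PlaneTree) (u : List ℕ) : ℕ := Set.ncard {i : ℕ | u ++ [i] ∈ τ.verts}

/-- The number of strict descendants of `u` in `τ`. -/
def descCount (τ : PlaneTree) (u : List ℕ) : ℕ :=
  Set.ncard {v : List ℕ | v ∈ τ.verts ∧ u <+: v ∧ v ≠ u}

/-- The number of vertices of the subtree grafted on `u` (that is, `u` and its descendants). -/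
def subtreeSize (τ : PlaneTree) (u : List ℕ) : ℕ :=
  Set.ncard {v : List ℕ | v ∈ τ.verts ∧ u <+: v}

/-- The height of `τ`: the maximal generation of a vertex. -/
def height (τ : PlaneTree) : ℕ := τ.verts.sup List.length

/-- The `j`-th vertex of `τ` in lexicographical order (starting from `j = 0` for the root). -/
def lexVertex (τ : PlaneTree) (j : ℕ) : List ℕ := (τ.verts.sort (· ≤ ·)).getD j []

/-- The Łukasiewicz path of `τ`: `W 0 = 0` and `W (j+1) = W j + k_{u(j)} - 1`, the vertices
being listed in lexicographical order. -/
def lukas (τ : PlaneTree) (j : ℕ) : ℤ :=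
  (((τ.verts.sort (· ≤ ·)).take j).map fun u => (τ.kc u : ℤ) - 1).sum

end PlaneTree

/-- `IsShape n θ τ f` expresses that the plane tree `τ` is the shape of the noncrossing tree
`θ`, the correspondence between the vertices of `τ` and those of `θ` being given by `f`:
`f` is a bijection sending the root of `τ` to the vertex `1` of `θ`, sending parent-child
pairs exactly to edges of `θ`, and the planar (clockwise, starting from the parent) order of
the children of each vertex agrees with their order in `τ`. -/
def IsShape (n : ℕ) (θ : NCTree n) (τ : PlaneTree) (f : List ℕ → Fin n) : Prop :=
  τ.verts.card = n ∧
  Set.BijOn f (↑τ.verts) Set.univ ∧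
  (f ([] : List ℕ)).val = 0 ∧
  (∀ u ∈ τ.verts, u ≠ [] → θ.adj.Adj (f u.dropLast) (f u)) ∧
  (∀ u ∈ τ.verts, ∀ v ∈ τ.verts, θ.adj.Adj (f u) (f v) → u = v.dropLast ∨ v = u.dropLast) ∧
  (∀ u ∈ τ.verts, ∀ i j : ℕ, 1 ≤ i → i < j → u ++ [j] ∈ τ.verts →
    f (u ++ [i]) - f u.dropLast < f (u ++ [j]) - f u.dropLast)

/-- `leftOf z w` : the point `w` lies in the (open) left half-plane bounded by the oriented
line from `z` to the complex number `1`. -/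
def leftOf (z w : ℂ) : Prop := 0 < ((starRingEnd ℂ) (1 - z) * (w - z)).im

/-- The number of children of the vertex of `θ` corresponding to the vertex `u` of its shape
`τ` which lie to the left of it (in the left half-plane bounded by the line joining it to the
complex number `1`). -/
def leftCount (n : ℕ) (θ : NCTree n) (τ : PlaneTree) (f : List ℕ → Fin n) (u : List ℕ) : ℕ :=
  Set.ncard {i : ℕ | u ++ [i] ∈ τ.verts ∧ leftOf (ncPos n (f u)) (ncPos n (f (u ++ [i])))}

/-- The degree of the vertex `v` in the noncrossing tree `θ`. -/
def ncDeg (n : ℕ) (θ : NCTree n) (v : Fin n) : ℕ := Set.ncard {w : Fin n | θ.adj.Adj v w}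

/-- The noncrossing tree `θ` viewed as the compact subset of the closed unit disk given by
the union of its edges. -/
def ncSet (n : ℕ) (θ : NCTree n) : Set ℂ :=
  ⋃ (a : Fin n) (b : Fin n) (_ : θ.adj.Adj a b), segment ℝ (ncPos n a) (ncPos n b)


/-- The weight `Ω^w(θ) = ∏_{u ∈ θ} w(deg u)` of a noncrossing tree. -/
def ncWeight (n : ℕ) (w : ℕ → ℝ) (θ : NCTree n) : ℝ := ∏ v : Fin n, w (ncDeg n θ v)

/-- The modified Bienaymé–Galton–Watson weight of a plane tree: the root reproduces according
to `μ0` and the other vertices according to `μ`. -/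
def bgwModW (μ0 μ : ℕ → ℝ) (τ : PlaneTree) : ℝ :=
  μ0 (τ.kc []) * ∏ u ∈ τ.verts.erase [], μ (τ.kc u)

/-- The total mass `BGW^{μ0,μ}(T_n)` given by the modified Bienaymé–Galton–Watson measure to
plane trees with `n` vertices. -/
def bgwModMass (μ0 μ : ℕ → ℝ) (n : ℕ) : ℝ :=
  ∑ᶠ τ ∈ {τ : PlaneTree | τ.verts.card = n}, bgwModW μ0 μ τ


/-! ### Geometry -/

def oD (x y z : ℂ) : ℝ := (y.re - x.re) * (z.im - x.im) - (y.im - x.im) * (z.re - x.re)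

lemma ncPos_re (n k : ℕ) : (ncPos n k).re = Real.cos (2 * Real.pi * k / n) := by
  have : -(2 * Real.pi * Complex.I) * k / n = ((-(2 * Real.pi * k / n) : ℝ) : ℂ) * Complex.I := by
    push_cast; ring
  rw [ncPos, this, Complex.exp_ofReal_mul_I_re, Real.cos_neg]

lemma ncPos_im (n k : ℕ) : (ncPos n k).im = - Real.sin (2 * Real.pi * k / n) := by
  have : -(2 * Real.pi * Complex.I) * k / n = ((-(2 * Real.pi * k / n) : ℝ) : ℂ) * Complex.I := by
    push_cast; ring
  rw [ncPos, this, Complex.exp_ofReal_mul_I_im, Real.sin_neg]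

lemma sin_pos_aux (x y : ℝ) :
    Real.sin (2 * x) + Real.sin (2 * y) - Real.sin (2 * (x + y)) =
      4 * Real.sin x * Real.sin y * Real.sin (x + y) := by
  have e : 2 * (x + y) = 2 * x + 2 * y := by ring
  rw [e, Real.sin_add (2 * x), Real.sin_add x y, Real.sin_two_mul, Real.sin_two_mul,
    Real.cos_two_mul, Real.cos_two_mul]
  have h1 := Real.sin_sq_add_cos_sq x
  have h2 := Real.sin_sq_add_cos_sq y
  have h1' : Real.cos x ^ 2 = 1 - Real.sin x ^ 2 := by linarith
  have h2' : Real.cos y ^ 2 = 1 - Real.sin y ^ 2 := by linarith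
  rw [h1', h2']
  ring

lemma oD_neg (n a b c : ℕ) (hab : a < b) (hbc : b < c) (hc : c < n) :
    oD (ncPos n a) (ncPos n b) (ncPos n c) < 0 := by
  have hn : (0 : ℝ) < n := by exact_mod_cast (by omega : 0 < n)
  set x : ℝ := Real.pi * ((b : ℝ) - a) / n with hx
  set y : ℝ := Real.pi * ((c : ℝ) - b) / n with hy
  have hab' : (a : ℝ) < b := by exact_mod_cast hab
  have hbc' : (b : ℝ) < c := by exact_mod_cast hbc
  have hc' : (c : ℝ) < n := by exact_mod_cast hc
  have ha' : (0 : ℝ) ≤ a := by positivity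
  have hpi := Real.pi_pos
  have hx0 : 0 < x := div_pos (mul_pos hpi (by linarith)) hn
  have hy0 : 0 < y := div_pos (mul_pos hpi (by linarith)) hn
  have hxy : x + y < Real.pi := by
    rw [hx, hy, ← add_div, div_lt_iff₀ hn, ← mul_add]
    exact mul_lt_mul_of_pos_left (by linarith) hpi
  have key := sin_pos_aux x y
  have p1 := Real.sin_pos_of_pos_of_lt_pi hx0 (by linarith)
  have p2 := Real.sin_pos_of_pos_of_lt_pi hy0 (by linarith)
  have p3 := Real.sin_pos_of_pos_of_lt_pi (by linarith : 0 < x + y) hxy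
  have p4 : 0 < 4 * Real.sin x * Real.sin y * Real.sin (x + y) := by positivity
  have e1 : 2 * x = 2 * Real.pi * b / n - 2 * Real.pi * a / n := by rw [hx]; ring
  have e2 : 2 * y = 2 * Real.pi * c / n - 2 * Real.pi * b / n := by rw [hy]; ring
  have e3 : 2 * (x + y) = 2 * Real.pi * c / n - 2 * Real.pi * a / n := by rw [hx, hy]; ring
  rw [← key, e1, e2, e3, Real.sin_sub, Real.sin_sub, Real.sin_sub] at p4
  simp only [oD, ncPos_re, ncPos_im]
  nlinarith [p4]

lemma oD_swap (x y z : ℂ) : oD x z y = - oD x y z := by simp only [oD]; ring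
lemma oD_rot (x y z : ℂ) : oD y z x = oD x y z := by simp only [oD]; ring

/-- third point outside the arc -/
lemma oD_pos_left (n a b c : ℕ) (hab : a < b) (hc : c < a) (hb : b < n) :
    oD (ncPos n a) (ncPos n b) (ncPos n c) < 0 := by
  rw [oD_rot]; exact oD_neg n c a b hc hab hb

lemma oD_pos_mid (n a b c : ℕ) (hac : a < c) (hcb : c < b) (hb : b < n) :
    0 < oD (ncPos n a) (ncPos n b) (ncPos n c) := by
  rw [oD_swap]; linarith [oD_neg n a c b hac hcb hb]

lemma ncPos_ne (n a b : ℕ) (hab : a ≠ b) (ha : a < n) (hb : b < n) : ncPos n a ≠ ncPos n b := by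
  wlog h : a < b generalizing a b
  · exact (this b a hab.symm hb ha (by omega)).symm
  intro e
  have hn : (0 : ℝ) < n := by exact_mod_cast (by omega : 0 < n)
  have h1 := congrArg Complex.re e
  have h2 := congrArg Complex.im e
  rw [ncPos_re, ncPos_re] at h1
  rw [ncPos_im, ncPos_im] at h2
  have h3 : Real.cos (2 * Real.pi * b / n - 2 * Real.pi * a / n) = 1 := by
    rw [Real.cos_sub, h1, neg_inj.1 h2]
    have := Real.sin_sq_add_cos_sq (2 * Real.pi * b / n)
    nlinarith
  have hab' : (a : ℝ) < b := by exact_mod_cast h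
  have hb' : (b : ℝ) < n := by exact_mod_cast hb
  have ha' : (0 : ℝ) ≤ a := by positivity
  have hpi := Real.pi_pos
  have e1 : 2 * Real.pi * b / n - 2 * Real.pi * a / n = 2 * Real.pi * (b - a) / n := by ring
  have l1 : 0 < 2 * Real.pi * (b - a) / n := div_pos (mul_pos (by linarith) (by linarith)) hn
  have l2 : 2 * Real.pi * (b - a) / n < 2 * Real.pi := by
    rw [div_lt_iff₀ hn]
    exact mul_lt_mul_of_pos_left (by linarith) (by linarith)
  rw [e1, Real.cos_eq_one_iff_of_lt_of_lt (by linarith) l2] at h3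
  linarith

/-- four points in convex position -/
lemma quad_meet (n a b c d : ℕ) (hab : a < b) (hbc : b < c) (hcd : c < d) (hd : d < n) :
    ∃ z, z ∈ segment ℝ (ncPos n a) (ncPos n c) ∧ z ∈ segment ℝ (ncPos n b) (ncPos n d) := by
  have h1 := oD_neg n b c d hbc hcd hd
  have h2 := oD_neg n a c d (by omega) hcd hd
  have h3 := oD_neg n a b d hab (by omega) hd
  have h4 := oD_neg n a b c hab hbc (by omega)
  generalize hA : ncPos n a = A at *
  generalize hB : ncPos n b = B at *
  generalize hC : ncPos n c = C at *
  generalize hD : ncPos n d = D at *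
  set S := oD B C D + oD A B D with hS
  have hSneg : S < 0 := by linarith
  have hS2 : S = oD A C D + oD A B C := by rw [hS]; simp only [oD]; ring
  refine ⟨(oD B C D / S) • A + (oD A B D / S) • C, ⟨_, _, div_nonneg_of_nonpos h1.le hSneg.le,
    div_nonneg_of_nonpos h3.le hSneg.le, ?_, rfl⟩, ⟨oD A C D / S, oD A B C / S,
    div_nonneg_of_nonpos h2.le hSneg.le, div_nonneg_of_nonpos h4.le hSneg.le, ?_, ?_⟩⟩
  · rw [← add_div, ← hS, div_self hSneg.ne]
  · rw [← add_div, ← hS2, div_self hSneg.ne]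
  · apply Complex.ext
    · simp only [Complex.add_re, Complex.real_smul, Complex.mul_re, Complex.ofReal_re,
        Complex.ofReal_im]
      field_simp
      simp only [oD]; ring
    · simp only [Complex.add_im, Complex.real_smul, Complex.mul_im, Complex.ofReal_re,
        Complex.ofReal_im]
      field_simp
      simp only [oD]; ring

def NCC {n : ℕ} (G : SimpleGraph (Fin n)) : Prop :=
  ∀ a b c d : Fin n, G.Adj a b → G.Adj c d → a < c → c < b → b < d → False

lemma NCTree.ncc {n : ℕ} (θ : NCTree n) : NCC θ.adj := by
  intro a b c d hab hcd h1 h2 h3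
  obtain ⟨z, hz1, hz2⟩ := quad_meet n a c b d h1 h2 h3 d.2
  have hne : ({(a : ℕ), (b : ℕ)} : Set ℕ) ≠ {(c : ℕ), (d : ℕ)} := by
    intro e
    have : (a : ℕ) ∈ ({(c : ℕ), (d : ℕ)} : Set ℕ) := e ▸ (by simp)
    simp only [Set.mem_insert_iff, Set.mem_singleton_iff] at this
    omega
  have := θ.noncrossing a b c d hab hcd hne ⟨hz1, hz2⟩
  obtain ⟨e1 | e1, e2 | e2⟩ := this
  · exact ncPos_ne n a c (by omega) a.2 c.2 (e1.symm.trans e2)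
  · exact ncPos_ne n a d (by omega) a.2 d.2 (e1.symm.trans e2)
  · exact ncPos_ne n b c (by omega) b.2 c.2 (e1.symm.trans e2)
  · exact ncPos_ne n b d (by omega) b.2 d.2 (e1.symm.trans e2)

lemma seg_noncross (n a b c d : ℕ) (hab : a < b) (hb : b < n) (hc : c < n) (hd : d < n)
    (hcd : c ≠ d) (hne : ({a, b} : Set ℕ) ≠ {c, d})
    (hs : (a ≤ c ∧ c ≤ b ∧ a ≤ d ∧ d ≤ b) ∨ ((c ≤ a ∨ b ≤ c) ∧ (d ≤ a ∨ b ≤ d))) :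
    segment ℝ (ncPos n a) (ncPos n b) ∩ segment ℝ (ncPos n c) (ncPos n d) ⊆
      {z : ℂ | (z = ncPos n a ∨ z = ncPos n b) ∧ (z = ncPos n c ∨ z = ncPos n d)} := by
  rintro z ⟨⟨s, t, hs0, ht0, hst, hz⟩, ⟨p, q, hp0, hq0, hpq, hz'⟩⟩
  have hL0 : oD (ncPos n a) (ncPos n b) z = 0 := by
    rw [← hz]
    have : s = 1 - t := by linarith
    subst this
    simp [oD]; ring
  have hL1 : p * oD (ncPos n a) (ncPos n b) (ncPos n c) +
      q * oD (ncPos n a) (ncPos n b) (ncPos n d) = 0 := by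
    rw [← hL0, ← hz']
    have : p = 1 - q := by linarith
    subst this
    simp [oD]; ring
  have hC : c = a ∨ c = b ∨ (c ≠ a ∧ c ≠ b) := by tauto
  have hD : d = a ∨ d = b ∨ (d ≠ a ∧ d ≠ b) := by tauto
  have oaa : oD (ncPos n a) (ncPos n b) (ncPos n a) = 0 := by simp [oD]
  have obb : oD (ncPos n a) (ncPos n b) (ncPos n b) = 0 := by simp [oD]; ring
  have side : ∀ e, e < n → e ≠ a → e ≠ b → 
      ((a < e ∧ e < b) ∧ 0 < oD (ncPos n a) (ncPos n b) (ncPos n e)) ∨ 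
      ((e < a ∨ b < e) ∧ oD (ncPos n a) (ncPos n b) (ncPos n e) < 0) := by
    intro e he h1 h2
    rcases lt_or_gt_of_ne h1 with h | h
    · exact Or.inr ⟨Or.inl h, oD_pos_left n a b e hab h hb⟩
    · rcases lt_or_gt_of_ne h2 with h' | h'
      · exact Or.inl ⟨⟨h, h'⟩, oD_pos_mid n a b e h h' hb⟩
      · exact Or.inr ⟨Or.inr h', oD_neg n a b e hab h' he⟩
  have conc1 : oD (ncPos n a) (ncPos n b) (ncPos n d) ≠ 0 → 
      oD (ncPos n a) (ncPos n b) (ncPos n c) = 0 → z = ncPos n c := by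
    intro h1 h2
    rw [h2] at hL1
    have : q = 0 := by simpa [h1] using hL1
    rw [← hz', this, show p = 1 by linarith]; simp
  have conc2 : oD (ncPos n a) (ncPos n b) (ncPos n c) ≠ 0 → 
      oD (ncPos n a) (ncPos n b) (ncPos n d) = 0 → z = ncPos n d := by
    intro h1 h2
    rw [h2] at hL1
    have : p = 0 := by simpa [h1] using hL1
    rw [← hz', this, show q = 1 by linarith]; simp
  have nz : ∀ e, e < n → e ≠ a → e ≠ b → oD (ncPos n a) (ncPos n b) (ncPos n e) ≠ 0 := by
    intro e he h1 h2
    rcases side e he h1 h2 with h | h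
    · exact h.2.ne'
    · exact h.2.ne
  rcases hC with rfl | rfl | ⟨hC1, hC2⟩
  · rcases hD with rfl | rfl | ⟨hD1, hD2⟩
    · exact absurd rfl hcd
    · exact absurd rfl hne
    · have := conc1 (nz d hd hD1 hD2) oaa
      exact ⟨Or.inl this, Or.inl this⟩
  · rcases hD with rfl | rfl | ⟨hD1, hD2⟩
    · exact absurd (Set.pair_comm _ _) hne
    · exact absurd rfl hcd
    · have := conc1 (nz d hd hD1 hD2) obb
      exact ⟨Or.inr this, Or.inl this⟩
  · rcases hD with rfl | rfl | ⟨hD1, hD2⟩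
    · have := conc2 (nz c hc hC1 hC2) oaa
      exact ⟨Or.inl this, Or.inr this⟩
    · have := conc2 (nz c hc hC1 hC2) obb
      exact ⟨Or.inr this, Or.inr this⟩
    · exfalso
      rcases side c hc hC1 hC2 with ⟨o1, l1⟩ | ⟨o1, l1⟩ <;>
      rcases side d hd hD1 hD2 with ⟨o2, l2⟩ | ⟨o2, l2⟩
      · rcases hp0.eq_or_lt with h | h
        · have : q = 1 := by linarith
          subst h this; linarith
        · nlinarith [mul_pos h l1, mul_nonneg hq0 l2.le]
      · omega
      · omega
      · rcases hp0.eq_or_lt with h | h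
        · have : q = 1 := by linarith
          subst h this; linarith
        · nlinarith [mul_neg_of_pos_of_neg h l1, mul_nonpos_of_nonneg_of_nonpos hq0 l2.le]

lemma noncrossing_of_ncc {n : ℕ} (G : SimpleGraph (Fin n)) (hG : NCC G) :
    ∀ a b c d : Fin n, G.Adj a b → G.Adj c d →
    ({(a : ℕ), (b : ℕ)} : Set ℕ) ≠ {(c : ℕ), (d : ℕ)} →
    segment ℝ (ncPos n a) (ncPos n b) ∩ segment ℝ (ncPos n c) (ncPos n d) ⊆
      {z : ℂ | (z = ncPos n a ∨ z = ncPos n b) ∧ (z = ncPos n c ∨ z = ncPos n d)} := by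
  intro a b c d hab hcd hne
  wlog h : a < b generalizing a b
  · have hba : b < a := lt_of_le_of_ne (not_lt.1 h) hab.ne.symm
    have := this b a hab.symm (by rwa [Set.pair_comm]) hba
    rw [segment_symm]
    intro z hz
    obtain ⟨h1, h2⟩ := this hz
    exact ⟨h1.symm, h2⟩
  apply seg_noncross n a b c d h b.2 c.2 d.2 (fun e => hcd.ne (Fin.ext e)) hne
  have k1 : ¬ (a < c ∧ c < b ∧ b < d) := fun h => hG a b c d hab hcd h.1 h.2.1 h.2.2
  have k2 : ¬ (a < d ∧ d < b ∧ b < c) := fun h => hG a b d c hab hcd.symm h.1 h.2.1 h.2.2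
  have k3 : ¬ (c < a ∧ a < d ∧ d < b) := fun h => hG c d a b hcd hab h.1 h.2.1 h.2.2
  have k4 : ¬ (d < a ∧ a < c ∧ c < b) := fun h => hG d c a b hcd.symm hab h.1 h.2.1 h.2.2
  simp only [Fin.lt_def] at k1 k2 k3 k4
  omega

/-! ### In-order traversals -/

lemma word_cases (u v : List ℕ) : u = v ∨ (∃ i s, v = u ++ i :: s) ∨ (∃ i s, u = v ++ i :: s) ∨
    ∃ p i j s t, i ≠ j ∧ u = p ++ i :: s ∧ v = p ++ j :: t := by
  induction u generalizing v with
  | nil => cases v with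
    | nil => exact Or.inl rfl
    | cons i s => exact Or.inr (Or.inl ⟨i, s, rfl⟩)
  | cons a u ih => cases v with
    | nil => exact Or.inr (Or.inr (Or.inl ⟨a, u, rfl⟩))
    | cons b v =>
      by_cases hab : a = b
      · subst hab
        rcases ih v with rfl | ⟨i, s, rfl⟩ | ⟨i, s, rfl⟩ | ⟨p, i, j, s, t, h, rfl, rfl⟩
        · exact Or.inl rfl
        · exact Or.inr (Or.inl ⟨i, s, rfl⟩)
        · exact Or.inr (Or.inr (Or.inl ⟨i, s, rfl⟩))
        · exact Or.inr (Or.inr (Or.inr ⟨a :: p, i, j, s, t, h, rfl, rfl⟩))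
      · exact Or.inr (Or.inr (Or.inr ⟨[], a, b, u, v, hab, rfl, rfl⟩))

lemma lex_branch (p : List ℕ) (x y : ℕ) (h : x < y) (xs ys : List ℕ) :
    p ++ x :: xs < p ++ y :: ys := by
  apply List.append_left_lt
  rw [List.cons_lt_cons_iff]
  exact Or.inl h

def wkey (c : List ℕ → ℕ) (u : List ℕ) : List ℕ := u.map (fun i => 2 * i) ++ [2 * c u + 1]

lemma wkey_desc (c : List ℕ → ℕ) (u : List ℕ) (i : ℕ) (s : List ℕ) :
    wkey c u < wkey c (u ++ i :: s) ↔ c u < i := by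
  have e : wkey c (u ++ i :: s) = u.map (fun i => 2 * i) ++ (2 * i) ::
    (s.map (fun i => 2 * i) ++ [2 * c (u ++ i :: s) + 1]) := by simp [wkey]
  rw [e]
  constructor
  · intro h
    by_contra h'
    exact lt_asymm h (lex_branch _ _ _ (by omega) _ _)
  · intro h
    exact lex_branch _ _ _ (by omega) _ _

lemma wkey_desc' (c : List ℕ → ℕ) (u : List ℕ) (i : ℕ) (s : List ℕ) :
    wkey c u ≠ wkey c (u ++ i :: s) := by
  have e : wkey c (u ++ i :: s) = u.map (fun i => 2 * i) ++ (2 * i) ::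
    (s.map (fun i => 2 * i) ++ [2 * c (u ++ i :: s) + 1]) := by simp [wkey]
  rw [e, wkey]
  intro h
  rw [List.append_cancel_left_eq] at h
  simp only [List.cons.injEq] at h
  omega

lemma wkey_branch (c : List ℕ → ℕ) (p : List ℕ) (i j : ℕ) (s t : List ℕ) (h : i < j) :
    wkey c (p ++ i :: s) < wkey c (p ++ j :: t) := by
  have e : ∀ i s, wkey c (p ++ i :: s) = p.map (fun i => 2 * i) ++ (2 * i) ::
    (s.map (fun i => 2 * i) ++ [2 * c (p ++ i :: s) + 1]) := by intro i s; simp [wkey]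
  rw [e, e]
  exact lex_branch _ _ _ (by omega) _ _

lemma wkey_inj (c : List ℕ → ℕ) : Function.Injective (wkey c) := by
  intro u v h
  rcases word_cases u v with h' | ⟨i, s, rfl⟩ | ⟨i, s, rfl⟩ | ⟨p, i, j, s, t, hij, rfl, rfl⟩
  · exact h'
  · exact absurd h (wkey_desc' _ _ _ _)
  · exact absurd h.symm (wkey_desc' _ _ _ _)
  · rcases lt_or_gt_of_ne hij with h' | h'
    · exact absurd h (wkey_branch c p i j s t h').ne
    · exact absurd h (wkey_branch c p j i t s h').ne'

structure InOrd (V : Finset (List ℕ)) (c : List ℕ → ℕ) {n : ℕ} (f : List ℕ → Fin n) : Prop where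
  bij : Set.BijOn f (↑V) Set.univ
  desc : ∀ u i s, u ∈ V → u ++ i :: s ∈ V → (f u < f (u ++ i :: s) ↔ c u < i)
  branch : ∀ p i j s t, i < j → p ++ i :: s ∈ V → p ++ j :: t ∈ V →
    f (p ++ i :: s) < f (p ++ j :: t)

lemma InOrd.exists (V : Finset (List ℕ)) (c : List ℕ → ℕ) {n : ℕ} (hn : 1 ≤ n) (hV : V.card = n) :
    ∃ f : List ℕ → Fin n, InOrd V c f := by
  classical
  have hcard : (V.image (wkey c)).card = n := by
    rw [Finset.card_image_of_injective _ (wkey_inj c), hV]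
  let e := (V.image (wkey c)).orderIsoOfFin hcard
  let f : List ℕ → Fin n := fun u => if h : wkey c u ∈ V.image (wkey c) then e.symm ⟨_, h⟩ else ⟨0, hn⟩
  have hf : ∀ u ∈ V, ∃ h : wkey c u ∈ V.image (wkey c), f u = e.symm ⟨_, h⟩ := by
    intro u hu
    have h : wkey c u ∈ V.image (wkey c) := Finset.mem_image_of_mem _ hu
    exact ⟨h, by simp only [f, dif_pos h]⟩
  have hlt : ∀ u ∈ V, ∀ v ∈ V, (f u < f v ↔ wkey c u < wkey c v) := by
    intro u hu v hv
    obtain ⟨h1, e1⟩ := hf u hu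
    obtain ⟨h2, e2⟩ := hf v hv
    rw [e1, e2, OrderIso.lt_iff_lt]
    exact Iff.rfl
  refine ⟨f, ⟨⟨fun _ _ => Set.mem_univ _, ?_, ?_⟩, ?_, ?_⟩⟩
  · intro u hu v hv huv
    obtain ⟨h1, e1⟩ := hf u hu
    obtain ⟨h2, e2⟩ := hf v hv
    rw [e1, e2] at huv
    have := e.symm.injective huv
    exact wkey_inj c (congrArg Subtype.val this)
  · intro x _
    obtain ⟨u, hu, hux⟩ := Finset.mem_image.1 (e x).2
    refine ⟨u, hu, ?_⟩
    obtain ⟨h1, e1⟩ := hf u hu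
    rw [e1]
    apply e.injective
    rw [OrderIso.apply_symm_apply]
    exact Subtype.ext hux
  · intro u i s hu hv
    rw [hlt _ hu _ hv, wkey_desc]
  · intro p i j s t hij hu hv
    rw [hlt _ hu _ hv]
    exact wkey_branch c p i j s t hij

lemma fin_rank {V : Finset (List ℕ)} {n : ℕ} {f : List ℕ → Fin n}
    (hf : Set.BijOn f (↑V) Set.univ) (u : List ℕ) :
    (f u).val = (V.filter (fun v => f v < f u)).card := by
  classical
  have : (Finset.Iio (f u)) = (V.filter (fun v => f v < f u)).image f := by
    ext x
    simp only [Finset.mem_Iio, Finset.mem_image, Finset.mem_filter]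
    constructor
    · intro h
      obtain ⟨v, hv, rfl⟩ := hf.surjOn (Set.mem_univ x)
      exact ⟨v, ⟨hv, h⟩, rfl⟩
    · rintro ⟨v, ⟨_, h⟩, rfl⟩; exact h
  have h2 := congrArg Finset.card this
  rw [Finset.card_image_of_injOn, Fin.card_Iio] at h2
  · exact h2
  · intro a ha b hb hab
    exact hf.injOn (by simpa using (Finset.mem_filter.1 ha).1)
      (by simpa using (Finset.mem_filter.1 hb).1) hab

lemma InOrd.ne {V : Finset (List ℕ)} {c : List ℕ → ℕ} {n : ℕ} {f : List ℕ → Fin n}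
    (hf : InOrd V c f) {u v : List ℕ} (hu : u ∈ V) (hv : v ∈ V) (h : u ≠ v) : f u ≠ f v :=
  fun e => h (hf.bij.injOn hu hv e)

lemma InOrd.desc' {V : Finset (List ℕ)} {c : List ℕ → ℕ} {n : ℕ} {f : List ℕ → Fin n}
    (hf : InOrd V c f) (u i s) (hu : u ∈ V) (hv : u ++ i :: s ∈ V) :
    (f (u ++ i :: s) < f u ↔ i ≤ c u) := by
  have h1 := hf.desc u i s hu hv
  have h2 := hf.ne hu hv (by simp)
  constructor
  · intro h
    by_contra h'
    exact lt_asymm h (h1.2 (by omega))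
  · intro h
    rcases lt_or_gt_of_ne h2 with h3 | h3
    · have := h1.1 h3; omega
    · exact h3

lemma InOrd.lt_iff {V : Finset (List ℕ)} {c : List ℕ → ℕ} {n : ℕ} {f g : List ℕ → Fin n}
    (hf : InOrd V c f) (hg : InOrd V c g) (u v : List ℕ) (hu : u ∈ V) (hv : v ∈ V) :
    f u < f v ↔ g u < g v := by
  rcases word_cases u v with rfl | ⟨i, s, rfl⟩ | ⟨i, s, rfl⟩ | ⟨p, i, j, s, t, hij, rfl, rfl⟩
  · simp
  · rw [hf.desc _ _ _ hu hv, hg.desc _ _ _ hu hv]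
  · rw [hf.desc' _ _ _ hv hu, hg.desc' _ _ _ hv hu]
  · rcases lt_or_gt_of_ne hij with h' | h'
    · exact iff_of_true (hf.branch _ _ _ _ _ h' hu hv) (hg.branch _ _ _ _ _ h' hu hv)
    · exact iff_of_false (hf.branch _ _ _ _ _ h' hv hu).asymm (hg.branch _ _ _ _ _ h' hv hu).asymm

lemma InOrd.unique {V : Finset (List ℕ)} {c : List ℕ → ℕ} {n : ℕ} {f g : List ℕ → Fin n}
    (hf : InOrd V c f) (hg : InOrd V c g) (u : List ℕ) (hu : u ∈ V) : f u = g u := by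
  apply Fin.ext
  rw [fin_rank hf.bij, fin_rank hg.bij]
  congr 1
  apply Finset.filter_congr
  intro v hv
  exact hf.lt_iff hg v u hv hu

/-- blocks are intervals -/
lemma InOrd.block {V : Finset (List ℕ)} {c : List ℕ → ℕ} {n : ℕ} {f : List ℕ → Fin n}
    (hf : InOrd V c f) {z u a b : List ℕ} (hz : z ∈ V) (ha : a ∈ V) (hb : b ∈ V)
    (hzu : ¬ u <+: z) (hua : u <+: a) (hub : u <+: b) : f z < f a ↔ f z < f b := by
  obtain ⟨a', rfl⟩ := hua
  obtain ⟨b', rfl⟩ := hub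
  rcases word_cases z u with rfl | ⟨i, s, rfl⟩ | ⟨i, s, rfl⟩ | ⟨p, i, j, s, t, hij, rfl, rfl⟩
  · exact absurd (List.prefix_refl _) hzu
  · rw [List.append_assoc, List.cons_append] at ha hb ⊢
    rw [List.append_assoc, List.cons_append]
    rw [hf.desc _ _ _ hz ha, hf.desc _ _ _ hz hb]
  · exact absurd (List.prefix_append _ _) hzu
  · rw [List.append_assoc, List.cons_append] at ha hb ⊢
    rw [List.append_assoc, List.cons_append]
    rcases lt_or_gt_of_ne hij with h' | h'
    · exact iff_of_true (hf.branch _ _ _ _ _ h' hz ha) (hf.branch _ _ _ _ _ h' hz hb)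
    · exact iff_of_false (hf.branch _ _ _ _ _ h' ha hz).asymm (hf.branch _ _ _ _ _ h' hb hz).asymm

/-- comparing differences in `Fin n` -/
lemma fin_sub_lt {n : ℕ} (x y z : Fin n) (h : z ≤ x ↔ z ≤ y) : x - z < y - z ↔ x < y := by
  simp only [Fin.lt_def, Fin.le_def, Fin.sub_def] at *
  have hx := x.2
  have hy := y.2
  have hz := z.2
  by_cases h1 : (z : ℕ) ≤ x
  · have h2 := h.1 h1
    rw [show n - (z : ℕ) + x = (x - z) + n by omega, show n - (z : ℕ) + y = (y - z) + n by omega,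
      Nat.add_mod_right, Nat.add_mod_right, Nat.mod_eq_of_lt (by omega),
      Nat.mod_eq_of_lt (by omega)]
    omega
  · have h2 : ¬ (z : ℕ) ≤ y := fun h2 => h1 (h.2 h2)
    rw [Nat.mod_eq_of_lt (by omega), Nat.mod_eq_of_lt (by omega)]
    omega

/-! ### From shapes to in-order traversals -/

lemma down_closed_eq (S : Set ℕ) (hS : S.Finite) (h1 : ∀ i ∈ S, 1 ≤ i)
    (h2 : ∀ i, 1 ≤ i → i + 1 ∈ S → i ∈ S) (i : ℕ) : i ∈ S ↔ 1 ≤ i ∧ i ≤ S.ncard := by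
  have down : ∀ k i, 1 ≤ i → i + k ∈ S → i ∈ S := by
    intro k
    induction k with
    | zero => intro i _ h; exact h
    | succ k ih => intro i hi h; exact ih i hi (h2 _ (by omega) h)
  constructor
  · intro hi
    refine ⟨h1 i hi, ?_⟩
    have : (↑(Finset.Icc 1 i) : Set ℕ) ⊆ S := by
      intro j hj
      simp only [Finset.coe_Icc, Set.mem_Icc] at hj
      exact down (i - j) j hj.1 (by rwa [show j + (i - j) = i by omega])
    have h3 := Set.ncard_le_ncard this hS
    rw [Set.ncard_coe_finset, Nat.card_Icc] at h3
    omega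
  · rintro ⟨hi, hi'⟩
    by_contra hn
    have : S ⊆ (↑(Finset.Icc 1 (i - 1)) : Set ℕ) := by
      intro j hj
      simp only [Finset.coe_Icc, Set.mem_Icc]
      refine ⟨h1 j hj, ?_⟩
      by_contra hji
      exact hn (down (j - i) i hi (by rwa [show i + (j - i) = j by omega]))
    have h3 := Set.ncard_le_ncard this (Finset.finite_toSet _)
    rw [Set.ncard_coe_finset, Nat.card_Icc] at h3
    omega

namespace PlaneTree

lemma mem_of_append (τ : PlaneTree) {u v : List ℕ} (h : u ++ v ∈ τ.verts) : u ∈ τ.verts :=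
  τ.prefix_closed _ _ (List.prefix_append _ _) h

lemma dropLast_mem (τ : PlaneTree) {u : List ℕ} (h : u ∈ τ.verts) : u.dropLast ∈ τ.verts :=
  τ.prefix_closed _ _ (List.dropLast_prefix u) h

lemma finite_children (τ : PlaneTree) (u : List ℕ) : {i : ℕ | u ++ [i] ∈ τ.verts}.Finite := by
  have : Set.InjOn (fun i : ℕ => u ++ [i]) ((fun i : ℕ => u ++ [i]) ⁻¹' ↑τ.verts) := by
    intro a _ b _ h; simpa using h
  exact Set.Finite.preimage this (Finset.finite_toSet _)

lemma mem_child_iff (τ : PlaneTree) (u : List ℕ) (i : ℕ) :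
    u ++ [i] ∈ τ.verts ↔ 1 ≤ i ∧ i ≤ τ.kc u := by
  refine down_closed_eq {i : ℕ | u ++ [i] ∈ τ.verts} (τ.finite_children u) ?_ ?_ i
  · intro i hi
    exact τ.labels_pos _ hi i (by simp)
  · intro i hi h
    exact τ.children_closed u i hi h

end PlaneTree

section shape
variable {n : ℕ} {θ : NCTree n} {τ : PlaneTree} {f : List ℕ → Fin n}

lemma IsShape.f_inj (h : IsShape n θ τ f) {u v : List ℕ} (hu : u ∈ τ.verts) (hv : v ∈ τ.verts)
    (e : f u = f v) : u = v := h.2.1.injOn hu hv e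

lemma IsShape.adj_child (h : IsShape n θ τ f) {u : List ℕ} {i : ℕ} (hu : u ++ [i] ∈ τ.verts) :
    θ.adj.Adj (f u) (f (u ++ [i])) := by
  have := h.2.2.2.1 (u ++ [i]) hu (by simp)
  simpa using this

/-- a vertex outside of the block of `a` is not between `a` and a child of `a` -/
lemma IsShape.not_between (h : IsShape n θ τ f) {a : List ℕ} {i : ℕ} (ha : a ++ [i] ∈ τ.verts)
    (z : List ℕ) (hz : z ∈ τ.verts) (haz : ¬ a <+: z) :
    (f z < f a ↔ f z < f (a ++ [i])) := by
  have ha' := τ.mem_of_append ha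
  have hadj := h.adj_child ha
  have nea : ∀ z ∈ τ.verts, ¬ a <+: z → f z ≠ f a ∧ f z ≠ f (a ++ [i]) := by
    intro z hz haz
    refine ⟨fun e => haz ?_, fun e => haz ?_⟩
    · rw [h.f_inj hz ha' e]
    · rw [h.f_inj hz ha e]; exact List.prefix_append _ _
  induction z using List.reverseRecOn with
  | nil =>
    have h0 := h.2.2.1
    have := nea [] hz haz
    simp only [ne_eq, Fin.ext_iff, Fin.lt_def, h0] at this ⊢
    omega
  | append_singleton z k ih =>
    have hz' := τ.mem_of_append hz
    have haz' : ¬ a <+: z := fun hh => haz (hh.trans (List.prefix_append _ _))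
    have ih' := ih hz' haz'
    have n1 := nea _ hz haz
    have n2 := nea _ hz' haz'
    have hadj' := h.adj_child hz
    have hG := θ.ncc
    generalize f (z ++ [k]) = x at *
    generalize f z = y at *
    generalize f a = p at *
    generalize f (a ++ [i]) = q at *
    have k1 := hG p q x y hadj hadj'.symm
    have k2 := hG q p x y hadj.symm hadj'.symm
    have k3 := hG y x p q hadj' hadj
    have k4 := hG y x q p hadj' hadj.symm
    have k1' : ¬ (p < x ∧ x < q ∧ q < y) := fun h => k1 h.1 h.2.1 h.2.2
    have k2' : ¬ (q < x ∧ x < p ∧ p < y) := fun h => k2 h.1 h.2.1 h.2.2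
    have k3' : ¬ (y < p ∧ p < x ∧ x < q) := fun h => k3 h.1 h.2.1 h.2.2
    have k4' : ¬ (y < q ∧ q < x ∧ x < p) := fun h => k4 h.1 h.2.1 h.2.2
    clear k1 k2 k3 k4 hG
    simp only [ne_eq, Fin.ext_iff, Fin.lt_def] at *
    omega

lemma IsShape.block_aux (h : IsShape n θ τ f) {z u : List ℕ} (s : List ℕ) (hz : z ∈ τ.verts)
    (ha : u ++ s ∈ τ.verts) (hzu : ¬ u <+: z) : f z < f u ↔ f z < f (u ++ s) := by
  induction s using List.reverseRecOn with
  | nil => simp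
  | append_singleton s i ih =>
    rw [← List.append_assoc] at ha ⊢
    rw [ih (τ.mem_of_append ha)]
    apply h.not_between ha z hz
    intro hh
    exact hzu ((List.prefix_append _ _).trans hh)

lemma IsShape.block_aux' (h : IsShape n θ τ f) {z u : List ℕ} (s : List ℕ) (hz : z ∈ τ.verts)
    (ha : u ++ s ∈ τ.verts) (hzu : ¬ u <+: z) : f u < f z ↔ f (u ++ s) < f z := by
  have h1 := h.block_aux s hz ha hzu
  have n1 : f z ≠ f u := fun e => hzu (by rw [h.f_inj hz (τ.mem_of_append ha) e])
  have n2 : f z ≠ f (u ++ s) := fun e => hzu (by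
    rw [h.f_inj hz ha e]; exact List.prefix_append _ _)
  simp only [ne_eq, Fin.ext_iff, Fin.lt_def] at *
  omega

lemma IsShape.child_lt (h : IsShape n θ τ f) (p : List ℕ) (i j : ℕ) (hij : i < j)
    (hi : p ++ [i] ∈ τ.verts) (hj : p ++ [j] ∈ τ.verts) : f (p ++ [i]) < f (p ++ [j]) := by
  have hp := τ.mem_of_append hi
  have h1 := h.2.2.2.2.2 p hp i j ((τ.mem_child_iff _ _).1 hi).1 hij hj
  rwa [fin_sub_lt] at h1
  by_cases hp0 : p = []
  · subst hp0
    have h0 := h.2.2.1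
    simp only [List.dropLast_nil, Fin.le_def, h0]
    simp
  · have hz := τ.dropLast_mem hp
    have hnp : ¬ p <+: p.dropLast := by
      intro hh
      have := hh.length_le
      rw [List.length_dropLast] at this
      have := List.length_pos_iff.2 hp0
      omega
    have e1 := h.block_aux [i] hz hi hnp
    have e2 := h.block_aux [j] hz hj hnp
    have n1 : f p.dropLast ≠ f (p ++ [i]) := fun e => hnp (by
      rw [h.f_inj hz hi e]; exact List.prefix_append _ _)
    have n2 : f p.dropLast ≠ f (p ++ [j]) := fun e => hnp (by
      rw [h.f_inj hz hj e]; exact List.prefix_append _ _)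
    simp only [ne_eq, Fin.ext_iff, Fin.lt_def, Fin.le_def] at *
    omega

def cOf (τ : PlaneTree) (f : List ℕ → Fin n) (u : List ℕ) : ℕ :=
  Set.ncard {i : ℕ | u ++ [i] ∈ τ.verts ∧ f (u ++ [i]) < f u}

lemma cOf_le (τ : PlaneTree) (f : List ℕ → Fin n) (u : List ℕ) : cOf τ f u ≤ τ.kc u :=
  Set.ncard_le_ncard (fun _ hi => hi.1) (τ.finite_children u)

lemma IsShape.cOf_root (h : IsShape n θ τ f) : cOf τ f [] = 0 := by
  rw [cOf, Set.ncard_eq_zero ((τ.finite_children []).subset (fun _ hi => hi.1))]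
  ext i
  simp only [Set.mem_setOf_eq, Set.mem_empty_iff_false, iff_false, not_and, Fin.lt_def, h.2.2.1]
  intro _; omega

lemma IsShape.lt_cOf (h : IsShape n θ τ f) (u : List ℕ) (i : ℕ) (hi : u ++ [i] ∈ τ.verts) :
    f (u ++ [i]) < f u ↔ i ≤ cOf τ f u := by
  have := down_closed_eq {i : ℕ | u ++ [i] ∈ τ.verts ∧ f (u ++ [i]) < f u}
    ((τ.finite_children u).subset (fun _ hi => hi.1))
    (fun i hi => ((τ.mem_child_iff u i).1 hi.1).1) (by
      rintro i hi ⟨h1, h2⟩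
      have h3 := τ.children_closed u i hi h1
      exact ⟨h3, (h.child_lt u i (i + 1) (by omega) h3 h1).trans h2⟩) i
  have h1 := ((τ.mem_child_iff u i).1 hi).1
  simp only [Set.mem_setOf_eq, hi, true_and, h1] at this
  exact this

lemma IsShape.inOrd (h : IsShape n θ τ f) : InOrd τ.verts (cOf τ f) f := by
  have pre : ∀ {p : List ℕ} {i s}, p ++ i :: s ∈ τ.verts → p ++ [i] ∈ τ.verts := by
    intro p i s hh
    exact τ.mem_of_append (v := s) (by simpa using hh)
  refine ⟨h.2.1, ?_, ?_⟩
  · intro u i s hu hv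
    have h1 := pre hv
    have h2 := h.lt_cOf u i h1
    have hnp : ¬ (u ++ [i]) <+: u := by
      intro hh; have := hh.length_le; simp at this
    have h3 := h.block_aux (u := u ++ [i]) s hu (by simpa using hv) hnp
    have e : u ++ [i] ++ s = u ++ i :: s := by simp
    rw [e] at h3
    rw [← h3]
    have n1 : f u ≠ f (u ++ [i]) := fun e => by
      have := h.f_inj hu h1 e; simp at this
    rw [← not_le (a := i), ← h2]
    simp only [ne_eq, Fin.ext_iff, Fin.lt_def] at *
    omega
  · intro p i j s t hij hi hj
    have h1 := pre hi
    have h2 := pre hj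
    have h3 := h.child_lt p i j hij h1 h2
    have e1 : p ++ [i] ++ s = p ++ i :: s := by simp
    have e2 : p ++ [j] ++ t = p ++ j :: t := by simp
    have hb1 := h.block_aux' (z := p ++ [j]) (u := p ++ [i]) s h2 (by rwa [e1]) (by
      intro hh; have := hh.eq_of_length (by simp); simp at this; omega)
    have hb2 := h.block_aux (z := p ++ i :: s) (u := p ++ [j]) t hi (by rwa [e2]) (by
      rw [List.prefix_append_right_inj]; simp; omega)
    rw [e1] at hb1
    rw [e2] at hb2
    exact hb2.1 (hb1.1 h3)

end shape

/-! ### From in-order traversals to noncrossing trees -/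

section build
variable {n : ℕ}

def buildRel (τ : PlaneTree) (f : List ℕ → Fin n) (x y : Fin n) : Prop :=
  ∃ u i, u ++ [i] ∈ τ.verts ∧ x = f u ∧ y = f (u ++ [i])

def buildGraph (τ : PlaneTree) (f : List ℕ → Fin n) : SimpleGraph (Fin n) :=
  SimpleGraph.fromRel (buildRel τ f)

lemma build_adj_child {τ : PlaneTree} {f : List ℕ → Fin n} (hf : Set.BijOn f (↑τ.verts) Set.univ)
    {u : List ℕ} {i : ℕ} (h : u ++ [i] ∈ τ.verts) : (buildGraph τ f).Adj (f u) (f (u ++ [i])) := by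
  rw [buildGraph, SimpleGraph.fromRel_adj]
  refine ⟨fun e => ?_, Or.inl ⟨u, i, h, rfl, rfl⟩⟩
  have := hf.injOn (τ.mem_of_append h) h e
  simp at this

lemma build_reach {τ : PlaneTree} {f : List ℕ → Fin n} (hf : Set.BijOn f (↑τ.verts) Set.univ)
    (u : List ℕ) (hu : u ∈ τ.verts) : (buildGraph τ f).Reachable (f []) (f u) := by
  induction u using List.reverseRecOn with
  | nil => exact SimpleGraph.Reachable.refl _
  | append_singleton u i ih =>
    exact (ih (τ.mem_of_append hu)).trans (build_adj_child hf hu).reachable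

lemma build_isTree {τ : PlaneTree} {f : List ℕ → Fin n} (hτ : τ.verts.card = n)
    (hf : Set.BijOn f (↑τ.verts) Set.univ) : (buildGraph τ f).IsTree := by
  classical
  have hconn : (buildGraph τ f).Connected := by
    have : Nonempty (Fin n) := ⟨f []⟩
    refine SimpleGraph.Connected.mk ?_
    intro x y
    obtain ⟨u, hu, rfl⟩ := hf.surjOn (Set.mem_univ x)
    obtain ⟨v, hv, rfl⟩ := hf.surjOn (Set.mem_univ y)
    exact (build_reach hf u hu).symm.trans (build_reach hf v hv)
  rw [SimpleGraph.isTree_iff_connected_and_card]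
  refine ⟨hconn, le_antisymm ?_ hconn.card_vert_le_card_edgeSet_add_one⟩
  have hsub : (buildGraph τ f).edgeSet ⊆
      ↑((τ.verts.erase []).image (fun u => s(f u.dropLast, f u))) := by
    intro e
    induction e using Sym2.ind with
    | _ x y =>
      intro h
      rw [SimpleGraph.mem_edgeSet, buildGraph, SimpleGraph.fromRel_adj] at h
      simp only [Finset.coe_image, Set.mem_image, Finset.mem_coe, Finset.mem_erase]
      obtain ⟨_, ⟨u, i, hu, rfl, rfl⟩ | ⟨u, i, hu, rfl, rfl⟩⟩ := h
      · exact ⟨u ++ [i], ⟨by simp, hu⟩, by simp⟩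
      · exact ⟨u ++ [i], ⟨by simp, hu⟩, by simp [Sym2.eq_swap]⟩
  have h1 := Set.ncard_le_ncard hsub (Finset.finite_toSet _)
  rw [Set.ncard_coe_finset] at h1
  have h2 := h1.trans Finset.card_image_le
  rw [Finset.card_erase_of_mem τ.root_mem, hτ] at h2
  have h3 : 0 < τ.verts.card := Finset.card_pos.2 ⟨_, τ.root_mem⟩
  rw [Nat.card_coe_set_eq, Nat.card_eq_fintype_card, Fintype.card_fin]
  omega

lemma build_ncc {τ : PlaneTree} {c : List ℕ → ℕ} {f : List ℕ → Fin n}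
    (hf : InOrd τ.verts c f) : NCC (buildGraph τ f) := by
  -- core statement on parent-child pairs
  have half : ∀ p i q k, p ++ [i] ∈ τ.verts → q ++ [k] ∈ τ.verts → ¬ p <+: q → p ≠ q ++ [k] →
      (f q < f p ↔ f q < f (p ++ [i])) ∧
      (f (q ++ [k]) < f p ↔ f (q ++ [k]) < f (p ++ [i])) := by
    intro p i q k hp hq h1 h2
    refine ⟨hf.block (τ.mem_of_append hq) (τ.mem_of_append hp) hp h1 (List.prefix_refl _)
      (List.prefix_append _ _), hf.block hq (τ.mem_of_append hp) hp ?_ (List.prefix_refl _)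
      (List.prefix_append _ _)⟩
    rw [List.prefix_concat_iff]
    tauto
  have core : ∀ p i q k, p ++ [i] ∈ τ.verts → q ++ [k] ∈ τ.verts → p ≠ q → p ≠ q ++ [k] →
      q ≠ p ++ [i] →
      ((f q < f p ↔ f q < f (p ++ [i])) ∧ (f (q ++ [k]) < f p ↔ f (q ++ [k]) < f (p ++ [i]))) ∨
      ((f p < f q ↔ f p < f (q ++ [k])) ∧ (f (p ++ [i]) < f q ↔ f (p ++ [i]) < f (q ++ [k]))) := by
    intro p i q k hp hq h1 h2 h3
    by_cases hpq : p <+: q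
    · right
      apply half q k p i hq hp _ h3
      intro hqp
      exact h1 (hpq.eq_of_length (le_antisymm hpq.length_le hqp.length_le))
    · left
      exact half p i q k hp hq hpq h2
  intro a b c' d hab hcd l1 l2 l3
  rw [buildGraph, SimpleGraph.fromRel_adj] at hab hcd
  obtain ⟨_, ⟨p, i, hp, rfl, rfl⟩ | ⟨p, i, hp, rfl, rfl⟩⟩ := hab <;>
  obtain ⟨_, ⟨q, k, hq, rfl, rfl⟩ | ⟨q, k, hq, rfl, rfl⟩⟩ := hcd <;>
  · have n1 : p ≠ q := by
      rintro rfl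
      first
      | exact lt_irrefl _ l1
      | exact lt_irrefl _ l2
      | exact lt_irrefl _ l3
      | exact lt_irrefl _ (l1.trans (l2.trans l3))
    have n2 : p ≠ q ++ [k] := by
      rintro rfl
      first
      | exact lt_irrefl _ l1
      | exact lt_irrefl _ l2
      | exact lt_irrefl _ l3
      | exact lt_irrefl _ (l1.trans (l2.trans l3))
    have n3 : q ≠ p ++ [i] := by
      rintro rfl
      first
      | exact lt_irrefl _ l1
      | exact lt_irrefl _ l2
      | exact lt_irrefl _ l3
      | exact lt_irrefl _ (l1.trans (l2.trans l3))
    have := core p i q k hp hq n1 n2 n3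
    simp only [Fin.lt_def] at *
    omega

def buildTree (τ : PlaneTree) (c : List ℕ → ℕ) (f : List ℕ → Fin n) (hτ : τ.verts.card = n)
    (hf : InOrd τ.verts c f) : NCTree n where
  adj := buildGraph τ f
  isTree := build_isTree hτ hf.bij
  noncrossing := noncrossing_of_ncc _ (build_ncc hf)

lemma buildTree_isShape (τ : PlaneTree) (c : List ℕ → ℕ) (hc : c [] = 0) (f : List ℕ → Fin n)
    (hτ : τ.verts.card = n)
    (hf : InOrd τ.verts c f) : IsShape n (buildTree τ c f hτ hf) τ f := by
  have hroot : ∀ u ∈ τ.verts, u ≠ [] → f [] < f u := by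
    intro u hu h0
    cases u with
    | nil => exact absurd rfl h0
    | cons i s =>
      have := hf.desc [] i s τ.root_mem (by simpa using hu)
      rw [hc] at this
      exact this.2 (τ.labels_pos _ hu i (by simp))
  refine ⟨hτ, hf.bij, ?_, ?_, ?_, ?_⟩
  · have h0 : 0 < n := (f []).pos
    obtain ⟨u, hu, hu0⟩ := hf.bij.surjOn (Set.mem_univ (⟨0, h0⟩ : Fin n))
    by_cases h : u = []
    · subst h; rw [hu0]
    · have := hroot u hu h
      rw [hu0, Fin.lt_def] at this
      simp at this
  · intro u hu h0
    obtain ⟨p, i, rfl⟩ : ∃ p i, u = p ++ [i] := ⟨_, _, (List.dropLast_append_getLast h0).symm⟩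
    have := build_adj_child hf.bij hu
    rw [List.dropLast_concat]
    exact this
  · intro u hu v hv h
    have h' : (buildGraph τ f).Adj (f u) (f v) := h
    rw [buildGraph, SimpleGraph.fromRel_adj] at h'
    obtain ⟨_, ⟨p, i, hp, e1, e2⟩ | ⟨p, i, hp, e1, e2⟩⟩ := h'
    · have e1' := hf.bij.injOn hu (τ.mem_of_append hp) e1
      have e2' := hf.bij.injOn hv hp e2
      subst e1' e2'
      left; simp
    · have e1' := hf.bij.injOn hv (τ.mem_of_append hp) e1
      have e2' := hf.bij.injOn hu hp e2
      subst e1' e2'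
      right; simp
  · intro u hu i j hi hij hj
    have hi' : u ++ [i] ∈ τ.verts := by
      rw [τ.mem_child_iff] at hj ⊢; omega
    rw [fin_sub_lt]
    · exact hf.branch u i j [] [] hij hi' hj
    · by_cases h0 : u = []
      · subst h0
        rw [List.dropLast_nil]
        exact iff_of_true (hroot _ hi' (by simp)).le (hroot _ hj (by simp)).le
      · have hz := τ.dropLast_mem hu
        have hnp : ¬ u <+: u.dropLast := by
          intro hh
          have := hh.length_le
          rw [List.length_dropLast] at this
          have := List.length_pos_iff.2 h0
          omega
        have e1 := hf.block hz hi' hj hnp (List.prefix_append _ _) (List.prefix_append _ _)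
        have n1 := hf.ne hz hi' (fun e => hnp (by rw [e]; exact List.prefix_append _ _))
        have n2 := hf.ne hz hj (fun e => hnp (by rw [e]; exact List.prefix_append _ _))
        simp only [ne_eq, Fin.ext_iff, Fin.lt_def, Fin.le_def] at *
        omega

end build

/-! ### Uniqueness of the shape, degrees -/

section uniq
variable {n : ℕ} {θ : NCTree n} {τ τ' : PlaneTree} {f f' : List ℕ → Fin n}

lemma IsShape.child_set (h : IsShape n θ τ f) {p : List ℕ} (hp : p ∈ τ.verts) (x : Fin n) :
    (θ.adj.Adj (f p) x ∧ x ≠ f p.dropLast) ↔ ∃ i, p ++ [i] ∈ τ.verts ∧ f (p ++ [i]) = x := by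
  constructor
  · rintro ⟨h1, h2⟩
    obtain ⟨v, hv, rfl⟩ := h.2.1.surjOn (Set.mem_univ x)
    rcases h.2.2.2.2.1 p hp v hv h1 with h3 | h3
    · have hv0 : v ≠ [] := by
        rintro rfl
        rw [List.dropLast_nil] at h3
        subst h3
        exact θ.adj.irrefl h1
      have e := List.dropLast_append_getLast hv0
      rw [← h3] at e
      exact ⟨_, by rw [e]; exact hv, by rw [e]⟩
    · exact absurd (by rw [h3]) h2
  · rintro ⟨i, hi, rfl⟩
    refine ⟨h.adj_child hi, fun e => ?_⟩
    have := h.f_inj hi (τ.dropLast_mem hp) e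
    have := congrArg List.length this
    simp at this
    omega

lemma IsShape.child_rank (h : IsShape n θ τ f) {p : List ℕ} {i : ℕ} (hi : p ++ [i] ∈ τ.verts) :
    i = Set.ncard {x : Fin n | (θ.adj.Adj (f p) x ∧ x ≠ f p.dropLast) ∧
      x - f p.dropLast ≤ f (p ++ [i]) - f p.dropLast} := by
  have hp := τ.mem_of_append hi
  have hi' := (τ.mem_child_iff p i).1 hi
  have : {x : Fin n | (θ.adj.Adj (f p) x ∧ x ≠ f p.dropLast) ∧
      x - f p.dropLast ≤ f (p ++ [i]) - f p.dropLast} =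
      (fun j => f (p ++ [j])) '' (↑(Finset.Icc 1 i) : Set ℕ) := by
    ext x
    simp only [Set.mem_setOf_eq, h.child_set hp, Set.mem_image, Finset.coe_Icc, Set.mem_Icc]
    constructor
    · rintro ⟨⟨j, hj, rfl⟩, hle⟩
      refine ⟨j, ⟨((τ.mem_child_iff p j).1 hj).1, ?_⟩, rfl⟩
      by_contra hlt
      have := h.2.2.2.2.2 p hp i j hi'.1 (by omega) hj
      exact absurd this (not_lt.2 hle)
    · rintro ⟨j, ⟨hj1, hj2⟩, rfl⟩
      refine ⟨⟨j, (τ.mem_child_iff p j).2 ⟨hj1, hj2.trans hi'.2⟩, rfl⟩, ?_⟩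
      rcases hj2.eq_or_lt with rfl | hlt
      · exact le_rfl
      · exact (h.2.2.2.2.2 p hp j i hj1 hlt hi).le
  rw [this, Set.ncard_image_of_injOn, Set.ncard_coe_finset, Nat.card_Icc]
  · omega
  · intro a ha b hb hab
    simp only [Finset.coe_Icc, Set.mem_Icc] at ha hb
    have := h.f_inj ((τ.mem_child_iff p a).2 ⟨ha.1, ha.2.trans hi'.2⟩)
      ((τ.mem_child_iff p b).2 ⟨hb.1, hb.2.trans hi'.2⟩) hab
    simpa using this

lemma IsShape.unique_aux (h : IsShape n θ τ f) (h' : IsShape n θ τ' f') (m : ℕ) :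
    ∀ u ∈ τ.verts, u.length ≤ m → u ∈ τ'.verts ∧ f u = f' u := by
  have root : ([] : List ℕ) ∈ τ'.verts ∧ f [] = f' [] :=
    ⟨τ'.root_mem, Fin.ext (h.2.2.1.trans h'.2.2.1.symm)⟩
  induction m with
  | zero =>
    intro u hu hl
    have : u = [] := List.eq_nil_of_length_eq_zero (by omega)
    subst this
    exact root
  | succ m ih =>
    intro u hu hl
    by_cases h0 : u = []
    · subst h0; exact root
    obtain ⟨p, i, rfl⟩ : ∃ p i, u = p ++ [i] := ⟨_, _, (List.dropLast_append_getLast h0).symm⟩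
    have hp := τ.mem_of_append hu
    simp only [List.length_append, List.length_singleton] at hl
    obtain ⟨hp', ep⟩ := ih p hp (by omega)
    obtain ⟨_, eq⟩ := ih p.dropLast (τ.dropLast_mem hp) (by rw [List.length_dropLast]; omega)
    have h1 := (h.child_set hp (f (p ++ [i]))).2 ⟨i, hu, rfl⟩
    rw [ep, eq] at h1
    obtain ⟨j, hj, ej⟩ := (h'.child_set hp' _).1 h1
    have r1 := h.child_rank hu
    have r2 := h'.child_rank hj
    rw [ej, ← ep, ← eq, ← r1] at r2
    subst r2
    exact ⟨hj, ej.symm⟩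

lemma PlaneTree.ext' {τ τ' : PlaneTree} (h : τ.verts = τ'.verts) : τ = τ' := by
  cases τ; cases τ'; simp only [PlaneTree.mk.injEq]; exact h

lemma IsShape.unique (h : IsShape n θ τ f) (h' : IsShape n θ τ' f') : τ = τ' := by
  apply PlaneTree.ext'
  ext u
  exact ⟨fun hu => (h.unique_aux h' _ u hu le_rfl).1, fun hu => (h'.unique_aux h _ u hu le_rfl).1⟩

lemma IsShape.unique_f (h : IsShape n θ τ f) (h' : IsShape n θ τ f') (u : List ℕ)
    (hu : u ∈ τ.verts) : f u = f' u := (h.unique_aux h' _ u hu le_rfl).2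

lemma NCTree.ext' {θ θ' : NCTree n} (h : θ.adj = θ'.adj) : θ = θ' := by
  cases θ; cases θ'; simp only [NCTree.mk.injEq]; exact h

lemma IsShape.adj_le {θ' : NCTree n} (h : IsShape n θ τ f) (h' : IsShape n θ' τ f')
    (hff : ∀ u ∈ τ.verts, f u = f' u) : θ.adj ≤ θ'.adj := by
  intro x y hxy
  obtain ⟨u, hu, rfl⟩ := h.2.1.surjOn (Set.mem_univ x)
  obtain ⟨v, hv, rfl⟩ := h.2.1.surjOn (Set.mem_univ y)
  have hne : u ≠ v := by rintro rfl; exact θ.adj.irrefl hxy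
  rw [hff u hu, hff v hv]
  rcases h.2.2.2.2.1 u hu v hv hxy with e | e
  · have hv0 : v ≠ [] := by rintro rfl; exact hne e
    rw [e]
    exact h'.2.2.2.1 v hv hv0
  · have hu0 : u ≠ [] := by rintro rfl; exact hne e.symm
    rw [e]
    exact (h'.2.2.2.1 u hu hu0).symm

lemma IsShape.tree_unique {θ' : NCTree n} (h : IsShape n θ τ f) (h' : IsShape n θ' τ f')
    (hff : ∀ u ∈ τ.verts, f u = f' u) : θ = θ' :=
  NCTree.ext' (le_antisymm (h.adj_le h' hff) (h'.adj_le h (fun u hu => (hff u hu).symm)))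

lemma IsShape.deg_aux (h : IsShape n θ τ f) {p : List ℕ} (hp : p ∈ τ.verts) :
    Set.ncard {x : Fin n | θ.adj.Adj (f p) x ∧ x ≠ f p.dropLast} = τ.kc p := by
  have : {x : Fin n | θ.adj.Adj (f p) x ∧ x ≠ f p.dropLast} =
      (fun j => f (p ++ [j])) '' {i : ℕ | p ++ [i] ∈ τ.verts} := by
    ext x
    simp only [Set.mem_setOf_eq, h.child_set hp, Set.mem_image]
  rw [this, Set.ncard_image_of_injOn]
  · rfl
  · intro a ha b hb hab
    have := h.f_inj ha hb hab
    simpa using this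

lemma IsShape.deg_root (h : IsShape n θ τ f) : ncDeg n θ (f []) = τ.kc [] := by
  rw [← h.deg_aux τ.root_mem, ncDeg]
  congr 1
  ext x
  simp only [Set.mem_setOf_eq, List.dropLast_nil]
  exact ⟨fun hh => ⟨hh, hh.ne'⟩, fun hh => hh.1⟩

lemma IsShape.deg_nonroot (h : IsShape n θ τ f) {p : List ℕ} (hp : p ∈ τ.verts) (h0 : p ≠ []) :
    ncDeg n θ (f p) = τ.kc p + 1 := by
  rw [← h.deg_aux hp, ncDeg, ← Set.ncard_insert_of_notMem (a := f p.dropLast) (by simp)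
    (Set.toFinite _)]
  congr 1
  ext x
  simp only [Set.mem_setOf_eq, Set.mem_insert_iff]
  have := (h.2.2.2.1 p hp h0).symm
  constructor
  · intro hh
    by_cases e : x = f p.dropLast
    · exact Or.inl e
    · exact Or.inr ⟨hh, e⟩
  · rintro (rfl | hh)
    · exact this
    · exact hh.1

lemma IsShape.weight (h : IsShape n θ τ f) (w : ℕ → ℝ) :
    ncWeight n w θ = w (τ.kc []) * ∏ u ∈ τ.verts.erase [], w (τ.kc u + 1) := by
  classical
  have h1 : ncWeight n w θ = ∏ u ∈ τ.verts, w (ncDeg n θ (f u)) := by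
    rw [ncWeight]
    symm
    refine Finset.prod_bij (fun u _ => f u) (fun _ _ => Finset.mem_univ _) ?_ ?_ (fun _ _ => rfl)
    · intro a ha b hb e
      exact h.f_inj ha hb e
    · intro x _
      obtain ⟨u, hu, e⟩ := h.2.1.surjOn (Set.mem_univ x)
      exact ⟨u, hu, e⟩
  rw [h1, ← Finset.mul_prod_erase _ _ τ.root_mem, h.deg_root]
  congr 1
  apply Finset.prod_congr rfl
  intro u hu
  rw [Finset.mem_erase] at hu
  rw [h.deg_nonroot hu.2 hu.1]

end uniq

/-! ### Existence of the shape -/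

lemma tree_parent {V : Type*} (G : SimpleGraph V) (hG : G.IsTree) (r : V) :
    ∃ (par : V → V) (d : V → ℕ), par r = r ∧ (∀ v, v ≠ r → G.Adj (par v) v ∧ d v = d (par v) + 1) ∧
      ∀ x y, G.Adj x y → (x = par y ∧ y ≠ r) ∨ (y = par x ∧ x ≠ r) := by
  choose P hP hPu using fun v => hG.existsUnique_path v r
  have hr : P r = SimpleGraph.Walk.nil := (hPu r _ SimpleGraph.Walk.IsPath.nil).symm
  refine ⟨fun v => (P v).snd, fun v => (P v).length, ?_, ?_, ?_⟩
  · simp [hr]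
  · intro v hv
    have hn : ¬ (P v).Nil := SimpleGraph.Walk.not_nil_of_ne hv
    refine ⟨(SimpleGraph.Walk.adj_snd hn).symm, ?_⟩
    have : (P v).tail = P (P v).snd := hPu _ _ (hP v).tail
    simp only
    rw [← this, SimpleGraph.Walk.length_tail_add_one hn]
  · intro x y hxy
    by_cases hy : y ∈ (P x).support
    · right
      refine ⟨hG.isAcyclic.eq_snd_of_adj_start (hP x) hxy hy, ?_⟩
      rintro rfl
      rw [hr] at hy
      simp at hy
      exact hxy.ne hy.symm
    · left
      have hq : (SimpleGraph.Walk.cons hxy.symm (P x)).IsPath := (hP x).cons hy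
      have := hPu _ _ hq
      refine ⟨?_, ?_⟩
      · show x = (P y).snd
        rw [← this]; simp
      · rintro rfl
        exact hy (SimpleGraph.Walk.end_mem_support _)

lemma rank_surj {α : Type*} [Fintype α] [DecidableEq α] {n : ℕ} (S : Finset α) (off : α → Fin n)
    (hoff : ∀ x ∈ S, ∀ y ∈ S, off x = off y → x = y) (i : ℕ) (h1 : 1 ≤ i) (h2 : i ≤ S.card) :
    ∃ x ∈ S, (S.filter (fun y => off y ≤ off x)).card = i := by
  classical
  set rk : α → ℕ := fun x => (S.filter (fun y => off y ≤ off x)).card with hrk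
  have hlt : ∀ x ∈ S, ∀ y ∈ S, off x < off y → rk x < rk y := by
    intro x hx y hy h
    apply Finset.card_lt_card
    rw [Finset.ssubset_iff_of_subset]
    · exact ⟨y, by simp [hy], by simp [hy, h]⟩
    · intro z hz
      rw [Finset.mem_filter] at hz ⊢
      exact ⟨hz.1, hz.2.trans h.le⟩
  have hinj : Set.InjOn rk S := by
    intro x hx y hy e
    by_contra hne
    rcases lt_or_gt_of_ne (fun e => hne (hoff x hx y hy e)) with h | h
    · exact absurd e (hlt x hx y hy h).ne
    · exact absurd e (hlt y hy x hx h).ne'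
  have : S.image rk = Finset.Icc 1 S.card := by
    apply Finset.eq_of_subset_of_card_le
    · intro k hk
      obtain ⟨x, hx, rfl⟩ := Finset.mem_image.1 hk
      rw [Finset.mem_Icc]
      exact ⟨Finset.card_pos.2 ⟨x, by simp [hx]⟩, Finset.card_filter_le _ _⟩
    · rw [Finset.card_image_of_injOn hinj, Nat.card_Icc]; omega
  have hi : i ∈ S.image rk := by rw [this, Finset.mem_Icc]; exact ⟨h1, h2⟩
  obtain ⟨x, hx, e⟩ := Finset.mem_image.1 hi
  exact ⟨x, hx, e⟩

lemma exists_words {n : ℕ} (r : Fin n) (par : Fin n → Fin n) (d : Fin n → ℕ) (rk : Fin n → ℕ)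
    (hd : ∀ v, v ≠ r → d v = d (par v) + 1) :
    ∃ W : Fin n → List ℕ, W r = [] ∧ ∀ v, v ≠ r → W v = W (par v) ++ [rk v] := by
  classical
  let F : ℕ → Fin n → List ℕ := fun k => Nat.rec (fun _ => [])
    (fun _ g v => if v = r then [] else g (par v) ++ [rk v]) k
  have hF : ∀ k v, F (k + 1) v = if v = r then [] else F k (par v) ++ [rk v] := fun _ _ => rfl
  refine ⟨fun v => F (d v) v, ?_, ?_⟩
  · show F (d r) r = []
    cases d r with
    | zero => rfl
    | succ k => rw [hF]; simp
  · intro v hv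
    show F (d v) v = F (d (par v)) (par v) ++ [rk v]
    rw [hd v hv, hF, if_neg hv]

lemma shape_exists {n : ℕ} (hn : 1 ≤ n) (θ : NCTree n) :
    ∃ (τ : PlaneTree) (f : List ℕ → Fin n), IsShape n θ τ f := by
  classical
  have : NeZero n := ⟨by omega⟩
  let r : Fin n := ⟨0, hn⟩
  obtain ⟨par, d, hpr, hpar, hadj⟩ := tree_parent θ.adj θ.isTree r
  let S : Fin n → Finset (Fin n) := fun p => Finset.univ.filter (fun x => x ≠ r ∧ par x = p)
  let rk : Fin n → ℕ := fun v =>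
    ((S (par v)).filter (fun x => x - par (par v) ≤ v - par (par v))).card
  obtain ⟨W, hWr, hW⟩ := exists_words r par d rk (fun v hv => (hpar v hv).2)
  have hS : ∀ p x, x ∈ S p ↔ x ≠ r ∧ par x = p := by intro p x; simp [S]
  have ind : ∀ (Q : Fin n → Prop), Q r → (∀ v, v ≠ r → Q (par v) → Q v) → ∀ v, Q v := by
    intro Q h0 h1
    have : ∀ k v, d v ≤ k → Q v := by
      intro k
      induction k with
      | zero =>
        intro v hv
        by_cases e : v = r
        · rw [e]; exact h0
        · have := (hpar v e).2; omega
      | succ k ih =>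
        intro v hv
        by_cases e : v = r
        · rw [e]; exact h0
        · have := (hpar v e).2
          exact h1 v e (ih _ (by omega))
    intro v
    exact this _ v le_rfl
  have hWd : ∀ v, (W v).dropLast = W (par v) := by
    intro v
    by_cases e : v = r
    · rw [e, hpr, hWr]; rfl
    · rw [hW v e]; simp
  have rk_lt : ∀ x y, x ≠ r → y ≠ r → par x = par y →
      x - par (par x) < y - par (par x) → rk x < rk y := by
    intro x y hx hy hxy hlt
    simp only [rk]
    rw [← hxy]
    apply Finset.card_lt_card
    rw [Finset.ssubset_iff_of_subset]
    · exact ⟨y, by simp [hS, hy, hxy], by simp [hlt]⟩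
    · intro z hz
      rw [Finset.mem_filter] at hz ⊢
      exact ⟨hz.1, hz.2.trans hlt.le⟩
  have rk_inj : ∀ x y, x ≠ r → y ≠ r → par x = par y → rk x = rk y → x = y := by
    intro x y hx hy hxy e
    rcases lt_trichotomy (x - par (par x)) (y - par (par x)) with h | h | h
    · exact absurd e (rk_lt x y hx hy hxy h).ne
    · exact sub_left_injective h
    · rw [hxy] at h
      exact absurd e (rk_lt y x hy hx hxy.symm h).ne'
  have hWinj : ∀ v v', W v = W v' → v = v' := by
    apply ind (fun v => ∀ v', W v = W v' → v = v')
    · intro v' h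
      by_contra hne
      rw [hWr, hW v' (Ne.symm hne)] at h
      simp at h
    · intro v hv ih v' h
      by_cases hv' : v' = r
      · rw [hv', hWr, hW v hv] at h
        simp at h
      · have h2 := h
        rw [hW v hv, hW v' hv'] at h2
        have h3 := List.append_inj' h2 rfl
        have h4 := ih _ h3.1
        exact rk_inj v v' hv hv' h4 (by simpa using h3.2)
  have rk_pos : ∀ v, v ≠ r → 1 ≤ rk v := by
    intro v hv
    exact Finset.card_pos.2 ⟨v, by simp [hS, hv]⟩
  have memW : ∀ u, u ∈ Finset.univ.image W ↔ ∃ v, W v = u := by intro u; simp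
  have last : ∀ v u i, W v = u ++ [i] → v ≠ r ∧ W (par v) = u ∧ rk v = i := by
    intro v u i h
    have hv : v ≠ r := by
      rintro rfl
      rw [hWr] at h; simp at h
    rw [hW v hv] at h
    have h3 := List.append_inj' h rfl
    exact ⟨hv, h3.1, by simpa using h3.2⟩
  let τ : PlaneTree :=
    { verts := Finset.univ.image W
      root_mem := (memW _).2 ⟨r, hWr⟩
      prefix_closed := by
        intro u v huv hv
        obtain ⟨s, rfl⟩ := huv
        induction s using List.reverseRecOn with
        | nil => simpa using hv
        | append_singleton s i ih =>
          apply ih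
          obtain ⟨x, hx⟩ := (memW _).1 hv
          rw [← List.append_assoc] at hx
          exact (memW _).2 ⟨par x, (last _ _ _ hx).2.1⟩
      labels_pos := by
        intro u hu
        obtain ⟨x, rfl⟩ := (memW _).1 hu
        clear hu
        revert x
        apply ind
        · rw [hWr]; simp
        · intro v hv ih i hi
          rw [hW v hv, List.mem_append] at hi
          rcases hi with hi | hi
          · exact ih i hi
          · rw [List.mem_singleton] at hi
            rw [hi]; exact rk_pos v hv
      children_closed := by
        intro u i hi hu
        obtain ⟨x, hx⟩ := (memW _).1 hu
        obtain ⟨h1, h2, h3⟩ := last _ _ _ hx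
        obtain ⟨y, hy, e⟩ := rank_surj (S (par x)) (fun y => y - par (par x))
          (fun a _ b _ hab => sub_left_injective hab) i hi (by
            have : rk x ≤ (S (par x)).card := Finset.card_filter_le _ _
            omega)
        rw [hS] at hy
        refine (memW _).2 ⟨y, ?_⟩
        rw [hW y hy.1, hy.2, h2]
        simp only [rk]
        rw [hy.2, e] }
  have hinj : Function.Injective W := fun a b h => hWinj a b h
  have : Nonempty (Fin n) := ⟨r⟩
  let f := Function.invFun W
  have hf : ∀ v, f (W v) = v := Function.leftInverse_invFun hinj
  have hτ : ∀ u, u ∈ τ.verts ↔ ∃ v, W v = u := memW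
  refine ⟨τ, f, ?_, ⟨fun _ _ => Set.mem_univ _, ?_, ?_⟩, ?_, ?_, ?_, ?_⟩
  · show (Finset.univ.image W).card = n
    rw [Finset.card_image_of_injective _ hinj]; simp
  · intro u hu v hv h
    obtain ⟨x, rfl⟩ := (hτ u).1 hu
    obtain ⟨y, rfl⟩ := (hτ v).1 hv
    rw [hf, hf] at h
    rw [h]
  · intro x _
    exact ⟨W x, (hτ _).2 ⟨x, rfl⟩, hf x⟩
  · rw [← hWr, hf]
  · intro u hu h0
    obtain ⟨x, rfl⟩ := (hτ u).1 hu
    rw [hWd, hf, hf]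
    refine (hpar x ?_).1
    rintro rfl
    exact h0 hWr
  · intro u hu v hv h
    obtain ⟨x, rfl⟩ := (hτ u).1 hu
    obtain ⟨y, rfl⟩ := (hτ v).1 hv
    rw [hf, hf] at h
    rw [hWd, hWd]
    rcases hadj x y h with ⟨h1, _⟩ | ⟨h1, _⟩
    · left; rw [h1]
    · right; rw [h1]
  · intro u hu i j hi hij hj
    have hi' := (τ.mem_child_iff u i).2 ⟨hi, hij.le.trans ((τ.mem_child_iff u j).1 hj).2⟩
    obtain ⟨x, rfl⟩ := (hτ u).1 hu
    obtain ⟨y, hy⟩ := (hτ _).1 hj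
    obtain ⟨z, hz⟩ := (hτ _).1 hi'
    rw [hWd, ← hy, ← hz, hf, hf, hf]
    obtain ⟨y1, y2, y3⟩ := last _ _ _ hy
    obtain ⟨z1, z2, z3⟩ := last _ _ _ hz
    have y4 := hinj y2
    have z4 := hinj z2
    by_contra hlt
    rcases (not_lt.1 hlt).eq_or_lt with h | h
    · have := sub_left_injective h
      subst this
      omega
    · have := rk_lt y z y1 z1 (y4.trans z4.symm) (by rw [y4]; exact h)
      omega

/-! ### Counting -/

instance (n : ℕ) : Finite (NCTree n) :=
  Finite.of_injective (fun θ : NCTree n => θ.adj) (fun _ _ h => NCTree.ext' h)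

lemma InOrd.cOf_eq {n : ℕ} {τ : PlaneTree} {c : List ℕ → ℕ} {f : List ℕ → Fin n}
    (hf : InOrd τ.verts c f) (u : List ℕ) (hu : u ∈ τ.verts) (hc : c u ≤ τ.kc u) :
    cOf τ f u = c u := by
  have : {i : ℕ | u ++ [i] ∈ τ.verts ∧ f (u ++ [i]) < f u} = ↑(Finset.Icc 1 (c u)) := by
    ext i
    simp only [Set.mem_setOf_eq, Finset.coe_Icc, Set.mem_Icc]
    constructor
    · rintro ⟨h1, h2⟩
      exact ⟨((τ.mem_child_iff u i).1 h1).1, (hf.desc' u i [] hu h1).1 h2⟩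
    · rintro ⟨h1, h2⟩
      have h3 := (τ.mem_child_iff u i).2 ⟨h1, h2.trans hc⟩
      exact ⟨h3, (hf.desc' u i [] hu h3).2 h2⟩
  rw [cOf, this, Set.ncard_coe_finset, Nat.card_Icc]
  omega

lemma count_shape {n : ℕ} (hn : 1 ≤ n) (τ : PlaneTree) (hτ : τ.verts.card = n) :
    Set.ncard {θ : NCTree n | ∃ f : List ℕ → Fin n, IsShape n θ τ f} =
      ∏ u ∈ τ.verts.erase [], (τ.kc u + 1) := by
  classical
  let P := (τ.verts.erase []).pi (fun u => Finset.range (τ.kc u + 1))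
  let ex : ((u : List ℕ) → u ∈ τ.verts.erase [] → ℕ) → List ℕ → ℕ :=
    fun c u => if h : u ∈ τ.verts.erase [] then c u h else 0
  choose F hF using fun c : List ℕ → ℕ => InOrd.exists τ.verts c hn hτ
  let Φ : ((u : List ℕ) → u ∈ τ.verts.erase [] → ℕ) → NCTree n :=
    fun c => buildTree τ (ex c) (F (ex c)) hτ (hF (ex c))
  have ex0 : ∀ c, ex c [] = 0 := by intro c; simp [ex]
  have hΦ : ∀ c, IsShape n (Φ c) τ (F (ex c)) := fun c =>
    buildTree_isShape τ (ex c) (ex0 c) _ hτ (hF (ex c))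
  have exle : ∀ c ∈ P, ∀ u, ex c u ≤ τ.kc u := by
    intro c hc u
    by_cases h : u ∈ τ.verts.erase []
    · have := Finset.mem_pi.1 hc u h
      rw [Finset.mem_range] at this
      simp only [ex, dif_pos h]; omega
    · simp only [ex, dif_neg h]; omega
  have himg : {θ : NCTree n | ∃ f : List ℕ → Fin n, IsShape n θ τ f} = Φ '' ↑P := by
    ext θ
    constructor
    · rintro ⟨f, hf⟩
      refine ⟨fun u _ => cOf τ f u, ?_, ?_⟩
      · rw [Finset.mem_coe, Finset.mem_pi]
        intro u _
        rw [Finset.mem_range]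
        have := cOf_le τ f u
        omega
      · refine (hΦ _).tree_unique hf ?_
        intro u hu
        have h1 := hf.inOrd
        have h2 := hF (ex (fun u _ => cOf τ f u))
        refine InOrd.unique (c := cOf τ f) ⟨h2.bij, ?_, h2.branch⟩ h1 u hu
        intro v i s hv hv'
        rw [h2.desc v i s hv hv']
        by_cases h0 : v = []
        · subst h0; simp [ex, hf.cOf_root]
        · have : v ∈ τ.verts.erase [] := Finset.mem_erase.2 ⟨h0, hv⟩
          simp only [ex, dif_pos this]
    · rintro ⟨c, _, rfl⟩
      exact ⟨_, hΦ c⟩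
  have hinj : Set.InjOn Φ ↑P := by
    intro c hc c' hc' h
    funext u hu
    have h1 := hΦ c
    rw [h] at h1
    have h2 := h1.unique_f (hΦ c')
    have hu' := (Finset.mem_erase.1 hu).2
    have e1 := (hF (ex c)).cOf_eq u hu' (exle c hc u)
    have e2 := (hF (ex c')).cOf_eq u hu' (exle c' hc' u)
    have e3 : cOf τ (F (ex c)) u = cOf τ (F (ex c')) u := by
      rw [cOf, cOf]
      congr 1
      ext i
      simp only [Set.mem_setOf_eq]
      apply and_congr_right
      intro hi
      rw [h2 _ hi, h2 _ hu']
    rw [e1, e2] at e3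
    simpa only [ex, dif_pos hu] using e3
  rw [himg, Set.ncard_image_of_injOn hinj, Set.ncard_coe_finset, Finset.card_pi]
  apply Finset.prod_congr rfl
  intro u _
  rw [Finset.card_range]

lemma sum_kc (τ : PlaneTree) : ∑ u ∈ τ.verts, τ.kc u = τ.verts.card - 1 := by
  classical
  rw [← Finset.card_erase_of_mem τ.root_mem,
    Finset.card_eq_sum_card_fiberwise (f := fun u : List ℕ => u.dropLast) (t := τ.verts)]
  · apply Finset.sum_congr rfl
    intro u hu
    rw [PlaneTree.kc, ← Set.ncard_coe_finset]
    have : (↑((τ.verts.erase []).filter (fun v : List ℕ => v.dropLast = u)) : Set (List ℕ)) =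
        (fun i : ℕ => u ++ [i]) '' {i : ℕ | u ++ [i] ∈ τ.verts} := by
      ext v
      simp only [Finset.coe_filter, Finset.mem_erase, Set.mem_setOf_eq, Set.mem_image]
      constructor
      · rintro ⟨⟨h0, hv⟩, rfl⟩
        have e := List.dropLast_append_getLast h0
        exact ⟨_, by rw [e]; exact hv, e⟩
      · rintro ⟨i, hi, rfl⟩
        exact ⟨⟨by simp, hi⟩, by simp⟩
    rw [this, Set.ncard_image_of_injective]
    intro a b h
    simpa using h
  · intro u hu
    exact τ.dropLast_mem (Finset.mem_erase.1 hu).2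

lemma shape_sum {n : ℕ} (hn : 1 ≤ n) (τ : PlaneTree) (hτ : τ.verts.card = n) (w : ℕ → ℝ) :
    (∑ᶠ θ ∈ {θ : NCTree n | ∃ f : List ℕ → Fin n, IsShape n θ τ f}, ncWeight n w θ) =
      w (τ.kc []) * ∏ u ∈ τ.verts.erase [], (((τ.kc u : ℝ) + 1) * w (τ.kc u + 1)) := by
  have hfin : {θ : NCTree n | ∃ f : List ℕ → Fin n, IsShape n θ τ f}.Finite := Set.toFinite _
  rw [finsum_mem_congr rfl (g := fun _ => w (τ.kc []) * ∏ u ∈ τ.verts.erase [], w (τ.kc u + 1))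
    (by rintro θ ⟨f, hf⟩; exact hf.weight w), finsum_mem_eq_finite_toFinset_sum _ hfin,
    Finset.sum_const, ← Set.ncard_eq_toFinset_card _ hfin, count_shape hn τ hτ, nsmul_eq_mul,
    Finset.prod_mul_distrib]
  push_cast
  ring

lemma bgw_eq {n : ℕ} (τ : PlaneTree) (hτ : τ.verts.card = n) (w : ℕ → ℝ) (A b C : ℝ) :
    bgwModW (fun k => C⁻¹ * w k * b ^ k) (fun k => A⁻¹ * ((k : ℝ) + 1) * w (k + 1) * b ^ k) τ =
      (C⁻¹ * A⁻¹ ^ (n - 1) * b ^ (n - 1)) *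
      (w (τ.kc []) * ∏ u ∈ τ.verts.erase [], (((τ.kc u : ℝ) + 1) * w (τ.kc u + 1))) := by
  rw [bgwModW]
  have h1 : ∏ u ∈ τ.verts.erase [], (A⁻¹ * ((τ.kc u : ℝ) + 1) * w (τ.kc u + 1) * b ^ τ.kc u) =
      A⁻¹ ^ (n - 1) * (∏ u ∈ τ.verts.erase [], (((τ.kc u : ℝ) + 1) * w (τ.kc u + 1))) *
        b ^ (∑ u ∈ τ.verts.erase [], τ.kc u) := by
    rw [← Finset.prod_pow_eq_pow_sum, ← hτ, ← Finset.card_erase_of_mem τ.root_mem,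
      ← Finset.prod_const, ← Finset.prod_mul_distrib, ← Finset.prod_mul_distrib]
    apply Finset.prod_congr rfl
    intro u _
    ring
  have h2 : τ.kc [] + ∑ u ∈ τ.verts.erase [], τ.kc u = n - 1 := by
    rw [Finset.add_sum_erase _ _ τ.root_mem, sum_kc, hτ]
  rw [h1, ← h2, pow_add b]
  ring

lemma sum_shapes {n : ℕ} (hn : 1 ≤ n) (g : NCTree n → ℝ) :
    (∑ᶠ τ ∈ {τ : PlaneTree | τ.verts.card = n},
      ∑ᶠ θ ∈ {θ : NCTree n | ∃ f : List ℕ → Fin n, IsShape n θ τ f}, g θ) = ∑ᶠ θ, g θ := by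
  classical
  have := Fintype.ofFinite (NCTree n)
  choose sh fs hsh using fun θ : NCTree n => shape_exists hn θ
  have hfib : ∀ θ τ, (∃ f : List ℕ → Fin n, IsShape n θ τ f) ↔ sh θ = τ := by
    intro θ τ
    constructor
    · rintro ⟨f, hf⟩
      exact (hsh θ).unique hf
    · rintro rfl
      exact ⟨_, hsh θ⟩
  have hset : {τ : PlaneTree | τ.verts.card = n} = ↑(Finset.univ.image sh) := by
    ext τ
    simp only [Set.mem_setOf_eq, Finset.coe_image, Finset.coe_univ, Set.image_univ, Set.mem_range]
    constructor
    · intro hτ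
      obtain ⟨f, hf⟩ := InOrd.exists τ.verts (fun _ => 0) hn hτ
      exact ⟨_, (hfib _ _).1 ⟨_, buildTree_isShape τ _ rfl f hτ hf⟩⟩
    · rintro ⟨θ, rfl⟩
      exact (hsh θ).1
  rw [hset, finsum_mem_coe_finset, finsum_eq_sum_of_fintype]
  rw [← Finset.sum_fiberwise_of_maps_to (s := Finset.univ) (t := Finset.univ.image sh) (g := sh)
    (fun θ _ => Finset.mem_image_of_mem _ (Finset.mem_univ θ))]
  apply Finset.sum_congr rfl
  intro τ _
  have : {θ : NCTree n | ∃ f : List ℕ → Fin n, IsShape n θ τ f} =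
      ↑(Finset.univ.filter (fun θ => sh θ = τ)) := by
    ext θ
    simp [hfib]
  rw [this, finsum_mem_coe_finset]

/-- Simply generated noncrossing trees are almost Bienaymé–Galton–Watson
trees: with `ρ = (limsup w(k)^{1/k})⁻¹ > 0`, `b ∈ (0,ρ)`,
`a = (Σ (k+1) w(k+1) bᵏ)⁻¹`, `c = (Σ w(k) bᵏ)⁻¹`, `μ(k) = a (k+1) w(k+1) bᵏ` and
`μ_∅(k) = c w(k) bᵏ`, for every `n` with `Z_n^w > 0` and every plane tree `τ` with `n`
vertices, the `ℙ_n^w`-probability that the shape of a noncrossing tree equals `τ` is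
`BGW^{μ_∅,μ}(τ) / BGW^{μ_∅,μ}(T_n)`. -/
theorem shape_of_simply_generated_is_bgw (w : ℕ → ℝ) (hw : ∀ k, 0 ≤ w k)
    (hρpos : 0 < (Filter.limsup
      (fun k : ℕ => ENNReal.ofReal (w k) ^ ((k : ℝ)⁻¹)) Filter.atTop)⁻¹)
    (b : ℝ) (hb : 0 < b)
    (hbρ : ENNReal.ofReal b < (Filter.limsup
      (fun k : ℕ => ENNReal.ofReal (w k) ^ ((k : ℝ)⁻¹)) Filter.atTop)⁻¹)
    (A C : ℝ) (hA : HasSum (fun k : ℕ => ((k : ℝ) + 1) * w (k + 1) * b ^ k) A) (hApos : 0 < A)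
    (hC : HasSum (fun k : ℕ => w k * b ^ k) C) (hCpos : 0 < C)
    (n : ℕ) (hn : 1 ≤ n)
    (hZ : 0 < ∑ᶠ θ : NCTree n, ncWeight n w θ)
    (τ : PlaneTree) (hτ : τ.verts.card = n) :
    (∑ᶠ θ ∈ {θ : NCTree n | ∃ f : List ℕ → Fin n, IsShape n θ τ f}, ncWeight n w θ) /
        (∑ᶠ θ : NCTree n, ncWeight n w θ) =
      bgwModW (fun k => C⁻¹ * w k * b ^ k)
          (fun k => A⁻¹ * ((k : ℝ) + 1) * w (k + 1) * b ^ k) τ /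
        bgwModMass (fun k => C⁻¹ * w k * b ^ k)
          (fun k => A⁻¹ * ((k : ℝ) + 1) * w (k + 1) * b ^ k) n := by
  have hK : (C⁻¹ * A⁻¹ ^ (n - 1) * b ^ (n - 1)) ≠ 0 := by positivity
  have hmass : bgwModMass (fun k => C⁻¹ * w k * b ^ k)
      (fun k => A⁻¹ * ((k : ℝ) + 1) * w (k + 1) * b ^ k) n =
      (C⁻¹ * A⁻¹ ^ (n - 1) * b ^ (n - 1)) * ∑ᶠ θ : NCTree n, ncWeight n w θ := by
    rw [bgwModMass, ← sum_shapes hn, mul_finsum_mem]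
    apply finsum_mem_congr rfl
    intro τ' hτ'
    rw [bgw_eq τ' hτ', shape_sum hn τ' hτ']
  rw [hmass, bgw_eq τ hτ, shape_sum hn τ hτ, mul_div_mul_left _ _ hK]

end
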